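/- Let A be a q×n complex matrix, W a nonzero n×q complex matrix, B a q×p complex matrix, m a positive integer, and k = max(Ind(AW), Ind(WA)). Then X = A^{Ⓦ_m,W,†}·B is the unique n×p matrix satisfying both ((WA)^k)^*·(WA)^{m+1}·X = ((WA)^k)^*·(WA)^{m+1}·A^†·B and range(X) ⊆ range((WA)^k). -/

import Mathlib

open Matrix

/-- Index of a square matrix: least `d` with `rank (B^d) = rank (B^(d+1))`. -/
noncomputable def matInd {ι : Type*} [Fintype ι] [DecidableEq ι] (B : Matrix ι ι ℂ) : ℕ :=
  sInf {d : ℕ | (B ^ d).rank = (B ^ (d + 1)).rank}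

/-- `X` is the Moore-Penrose inverse of `A` (four Penrose equations). -/
noncomputable def IsMP {ι κ : Type*} [Fintype ι] [Fintype κ] (A : Matrix ι κ ℂ) (X : Matrix κ ι ℂ) : Prop :=
  A * X * A = A ∧ X * A * X = X ∧ (A * X)ᴴ = A * X ∧ (X * A)ᴴ = X * A

/-- Column space (range) of a matrix. -/
noncomputable def mrange {ι κ : Type*} [Fintype κ] (M : Matrix ι κ ℂ) : Submodule ℂ (ι → ℂ) :=
  LinearMap.range M.mulVecLin

/-- Null space of a matrix. -/
noncomputable def mker {ι κ : Type*} [Fintype κ] (M : Matrix ι κ ℂ) : Submodule ℂ (κ → ℂ) :=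
  LinearMap.ker M.mulVecLin

/-- `X` is the core-EP inverse of `B`. -/
noncomputable def IsCoreEP {ι : Type*} [Fintype ι] [DecidableEq ι] (B X : Matrix ι ι ℂ) : Prop :=
  X * B * X = X ∧ mrange X = mrange (B ^ matInd B) ∧ mrange Xᴴ = mrange (B ^ matInd B)

/-- `X` is the Drazin inverse of `B`. -/
noncomputable def IsDrazin {ι : Type*} [Fintype ι] [DecidableEq ι] (B X : Matrix ι ι ℂ) : Prop :=
  X * B * X = X ∧ B * X = X * B ∧ B ^ (matInd B + 1) * X = B ^ matInd B

/-- `X` is the group inverse of `B`. -/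
noncomputable def IsGroupInv {ι : Type*} [Fintype ι] (B X : Matrix ι ι ℂ) : Prop :=
  B * X * B = B ∧ X * B * X = X ∧ B * X = X * B

/-- Frobenius norm of a matrix. -/
noncomputable def frobNorm {ι κ : Type*} [Fintype ι] [Fintype κ] (M : Matrix ι κ ℂ) : ℝ :=
  Real.sqrt (∑ i, ∑ j, ‖M i j‖ ^ 2)

/-- Inclusion of column spaces gives a factorization. -/
lemma exists_eq_mul_of_mrange_le {ι κ τ : Type*} [Fintype κ] [Fintype τ]
    {X : Matrix ι κ ℂ} {Y : Matrix ι τ ℂ} (h : mrange X ≤ mrange Y) :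
    ∃ Z : Matrix τ κ ℂ, X = Y * Z := by
  classical
  have hcol : ∀ j, ∃ z : τ → ℂ, Y *ᵥ z = X.col j := fun j => by
    have hj : X.col j ∈ mrange Y := h ⟨Pi.single j 1, by simp⟩
    exact hj
  choose z hz using hcol
  refine ⟨Matrix.of fun i j => z j i, ?_⟩
  ext i j
  exact (congrFun (hz j) i).symm

lemma mrange_mul_le {ι κ τ : Type*} [Fintype κ] [Fintype τ]
    (Y : Matrix ι τ ℂ) (Z : Matrix τ κ ℂ) : mrange (Y * Z) ≤ mrange Y := by
  rintro _ ⟨v, rfl⟩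
  exact ⟨Z *ᵥ v, by simp⟩

section MatInd

variable {ι : Type*} [Fintype ι] [DecidableEq ι]

lemma rank_pow_matInd (M : Matrix ι ι ℂ) :
    (M ^ matInd M).rank = (M ^ (matInd M + 1)).rank := by
  have hne : {d : ℕ | (M ^ d).rank = (M ^ (d + 1)).rank}.Nonempty := by
    by_contra hempty
    have hlt : ∀ d, (M ^ (d + 1)).rank < (M ^ d).rank := fun d =>
      lt_of_le_of_ne (by rw [pow_succ]; exact Matrix.rank_mul_le_left _ _)
        fun h => hempty ⟨d, h.symm⟩
    have hbound : ∀ d, (M ^ d).rank + d ≤ (M ^ 0).rank := fun d => by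
      induction d with
      | zero => simp
      | succ d ih => have := hlt d; omega
    have := hbound ((M ^ 0).rank + 1)
    omega
  exact Nat.sInf_mem hne

lemma exists_pow_matInd_eq_pow_succ_mul (M : Matrix ι ι ℂ) :
    ∃ K, M ^ matInd M = M ^ (matInd M + 1) * K := by
  apply exists_eq_mul_of_mrange_le
  have hle : mrange (M ^ (matInd M + 1)) ≤ mrange (M ^ matInd M) := by
    rw [pow_succ]
    exact mrange_mul_le _ _
  exact (Submodule.eq_of_le_of_finrank_eq hle (rank_pow_matInd M).symm).ge

lemma exists_pow_matInd_eq_pow_mul (M : Matrix ι ι ℂ) {k : ℕ} (hk : matInd M ≤ k) :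
    ∃ K, M ^ matInd M = M ^ k * K := by
  induction k, hk using Nat.le_induction with
  | base => exact ⟨1, by simp⟩
  | succ k _ ih =>
    obtain ⟨K, hK⟩ := ih
    obtain ⟨L, hL⟩ := exists_pow_matInd_eq_pow_succ_mul M
    refine ⟨K * L, ?_⟩
    calc M ^ matInd M = M * M ^ matInd M * L := by rw [← pow_succ', ← hL]
      _ = M * (M ^ k * K) * L := by rw [← hK]
      _ = M ^ (k + 1) * (K * L) := by simp only [pow_succ', Matrix.mul_assoc]

end MatInd

namespace IsCoreEP

variable {ι : Type*} [Fintype ι] [DecidableEq ι] {M C : Matrix ι ι ℂ}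

lemma mul_mul_pow (h : IsCoreEP M C) {k : ℕ} (hk : matInd M ≤ k) :
    C * M * M ^ k = M ^ k := by
  obtain ⟨h1, h2, -⟩ := h
  obtain ⟨F, hF⟩ := exists_eq_mul_of_mrange_le h2.ge
  rw [← Nat.add_sub_cancel' hk, pow_add, hF, ← Matrix.mul_assoc, ← Matrix.mul_assoc, h1]

lemma mul_inv_mul_pow (h : IsCoreEP M C) {k : ℕ} (hk : matInd M ≤ k) :
    M * C * M ^ k = M ^ k := by
  obtain ⟨K, hK⟩ := exists_pow_matInd_eq_pow_succ_mul M
  have hbase : M * C * M ^ matInd M = M ^ matInd M :=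
    calc M * C * M ^ matInd M = M * (C * M * M ^ matInd M) * K := by
          conv_lhs => rw [hK]
          simp only [pow_succ', Matrix.mul_assoc]
      _ = M ^ matInd M := by rw [h.mul_mul_pow le_rfl, ← pow_succ', ← hK]
  rw [← Nat.add_sub_cancel' hk, pow_add, ← Matrix.mul_assoc, hbase]

lemma mul_inv_mul_inv (h : IsCoreEP M C) : M * C * C = C := by
  obtain ⟨E, hE⟩ := exists_eq_mul_of_mrange_le h.2.1.le
  have h3 : M * C * (M ^ matInd M * E) = M ^ matInd M * E := by
    rw [← Matrix.mul_assoc, h.mul_inv_mul_pow le_rfl]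
  rwa [← hE] at h3

lemma conjTranspose_mul_inv (h : IsCoreEP M C) : (M * C)ᴴ = M * C := by
  obtain ⟨G, hG⟩ := exists_eq_mul_of_mrange_le h.2.2.le
  have h3 : M * C * Cᴴ = Cᴴ := by
    rw [hG, ← Matrix.mul_assoc, h.mul_inv_mul_pow le_rfl]
  have h4 : M * C * (M * C)ᴴ = (M * C)ᴴ := by
    rw [conjTranspose_mul, ← Matrix.mul_assoc, h3]
  have h5 := congrArg conjTranspose h4
  rw [conjTranspose_mul, conjTranspose_conjTranspose] at h5
  exact h4.symm.trans h5

lemma exists_eq_mul_conjTranspose_pow (h : IsCoreEP M C) {k : ℕ} (hk : matInd M ≤ k) :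
    ∃ U, C = U * (M ^ k)ᴴ := by
  obtain ⟨G, hG⟩ := exists_eq_mul_of_mrange_le h.2.2.le
  obtain ⟨K, hK⟩ := exists_pow_matInd_eq_pow_mul M hk
  refine ⟨(K * G)ᴴ, ?_⟩
  rw [← conjTranspose_mul, ← Matrix.mul_assoc, ← hK, ← hG, conjTranspose_conjTranspose]

lemma pow_succ_mul_inv_pow_succ (h : IsCoreEP M C) (m : ℕ) :
    M ^ (m + 1) * C ^ (m + 1) = M * C := by
  induction m with
  | zero => simp
  | succ m ih =>
    calc M ^ (m + 1 + 1) * C ^ (m + 1 + 1) = M ^ (m + 1) * (M * C * C) * C ^ m := by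
          rw [pow_succ M, pow_succ' C, pow_succ' C]
          simp only [Matrix.mul_assoc]
      _ = M * C := by rw [h.mul_inv_mul_inv, Matrix.mul_assoc, ← pow_succ', ih]

lemma inv_pow_mul_pow_mul_pow (h : IsCoreEP M C) {k : ℕ} (hk : matInd M ≤ k) (m : ℕ) :
    C ^ m * M ^ m * M ^ k = M ^ k := by
  induction m with
  | zero => simp
  | succ m ih =>
    calc C ^ (m + 1) * M ^ (m + 1) * M ^ k = C ^ m * (C * M * M ^ (m + k)) := by
          rw [pow_succ C, pow_succ' M, pow_add]
          simp only [Matrix.mul_assoc]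
      _ = M ^ k := by rw [h.mul_mul_pow (by omega), pow_add, ← Matrix.mul_assoc, ih]

end IsCoreEP

/-- Moving a factor through a power of a product of rectangular matrices. -/
lemma mul_mul_pow_comm {ι κ : Type*} [Fintype ι] [Fintype κ] [DecidableEq ι] [DecidableEq κ]
    (W : Matrix ι κ ℂ) (N : Matrix κ ι ℂ) (m : ℕ) : W * (N * W) ^ m = (W * N) ^ m * W := by
  induction m with
  | zero => simp
  | succ m ih =>
    rw [pow_succ, ← Matrix.mul_assoc, ih, pow_succ]
    simp only [Matrix.mul_assoc]

theorem stmt16 {q n p : ℕ} (A : Matrix (Fin q) (Fin n) ℂ) (W : Matrix (Fin n) (Fin q) ℂ)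
    (hW : W ≠ 0) (B : Matrix (Fin q) (Fin p) ℂ) (m : ℕ) (hm : 0 < m) (k : ℕ)
    (hk : k = max (matInd (A * W)) (matInd (W * A)))
    (Adag : Matrix (Fin n) (Fin q) ℂ) (hAdag : IsMP A Adag)
    (WAcep : Matrix (Fin n) (Fin n) ℂ) (hWAcep : IsCoreEP (W * A) WAcep)
    (AepW AWGm : Matrix (Fin q) (Fin n) ℂ) (AWGMP : Matrix (Fin n) (Fin q) ℂ)
    (hAepW : AepW = A * (WAcep * WAcep))
    (hAWGm : AWGm = (AepW * W) ^ m * AepW * (W * A) ^ m)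
    (hAWGMP : AWGMP = W * AWGm * W * A * Adag) :
    (((W * A) ^ k)ᴴ * (W * A) ^ (m + 1) * (AWGMP * B) =
        ((W * A) ^ k)ᴴ * (W * A) ^ (m + 1) * Adag * B ∧
      mrange (AWGMP * B) ≤ mrange ((W * A) ^ k)) ∧
    ∀ X : Matrix (Fin n) (Fin p) ℂ,
      ((W * A) ^ k)ᴴ * (W * A) ^ (m + 1) * X = ((W * A) ^ k)ᴴ * (W * A) ^ (m + 1) * Adag * B →
      mrange X ≤ mrange ((W * A) ^ k) → X = AWGMP * B := by
  have hk' : matInd (W * A) ≤ k := hk ▸ le_max_right _ _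
  have hWN : W * AepW = WAcep := by
    rw [hAepW, ← Matrix.mul_assoc, ← Matrix.mul_assoc, hWAcep.mul_inv_mul_inv]
  have hG : AWGMP = WAcep ^ (m + 1) * (W * A) ^ (m + 1) * Adag := by
    have hcomm : W * ((AepW * W) ^ m * AepW) = WAcep ^ (m + 1) := by
      rw [← Matrix.mul_assoc, mul_mul_pow_comm, Matrix.mul_assoc, hWN, ← pow_succ]
    rw [hAWGMP, hAWGm, ← hcomm, pow_succ (W * A)]
    simp only [Matrix.mul_assoc]
  set M := W * A
  set C := WAcep
  have hproj : (M ^ k)ᴴ * (M ^ (m + 1) * C ^ (m + 1)) = (M ^ k)ᴴ := by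
    rw [hWAcep.pow_succ_mul_inv_pow_succ, ← hWAcep.conjTranspose_mul_inv, ← conjTranspose_mul,
      hWAcep.mul_inv_mul_pow hk']
  have heq : (M ^ k)ᴴ * M ^ (m + 1) * (AWGMP * B) = (M ^ k)ᴴ * M ^ (m + 1) * Adag * B := by
    calc (M ^ k)ᴴ * M ^ (m + 1) * (AWGMP * B)
        = (M ^ k)ᴴ * (M ^ (m + 1) * C ^ (m + 1)) * M ^ (m + 1) * Adag * B := by
          rw [hG]
          simp only [Matrix.mul_assoc]
      _ = (M ^ k)ᴴ * M ^ (m + 1) * Adag * B := by rw [hproj]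
  have hrange : mrange (AWGMP * B) ≤ mrange (M ^ k) := by
    obtain ⟨K, hK⟩ := exists_pow_matInd_eq_pow_mul M hk'
    have hC : mrange C ≤ mrange (M ^ k) := by
      rw [hWAcep.2.1, hK]
      exact mrange_mul_le _ _
    rw [hG, pow_succ' C]
    simp only [Matrix.mul_assoc]
    exact (mrange_mul_le _ _).trans hC
  refine ⟨⟨heq, hrange⟩, fun X hX hXr => ?_⟩
  obtain ⟨U, hU⟩ := hWAcep.exists_eq_mul_conjTranspose_pow hk'
  have hrecover : ∀ Y : Matrix (Fin n) (Fin p) ℂ, mrange Y ≤ mrange (M ^ k) →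
      Y = C ^ m * (U * ((M ^ k)ᴴ * M ^ (m + 1) * Y)) := fun Y hY => by
    obtain ⟨Z, rfl⟩ := exists_eq_mul_of_mrange_le hY
    calc M ^ k * Z = C ^ (m + 1) * M ^ (m + 1) * M ^ k * Z := by
          rw [hWAcep.inv_pow_mul_pow_mul_pow hk']
      _ = C ^ m * (U * (M ^ k)ᴴ) * M ^ (m + 1) * M ^ k * Z := by rw [← hU, ← pow_succ]
      _ = _ := by simp only [Matrix.mul_assoc]
  rw [hrecover X hXr, hX, ← heq, ← hrecover _ hrange]
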